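/- Let G be a torsion-free abelian group, R a G-graded domain, and S a graded overring of R. The following are equivalent: (1) S is flat as an R-module; (2) S_(𝔭) = R_(𝔭∩R) for every homogeneous prime 𝔭 of S; (3) S_(𝔫) = R_(𝔫∩R) for every graded maximal ideal 𝔫 of S. -/

import Mathlib

/-! Core definitions for graded perinormality, following Epstein–Shapiro style graded notions. -/

section Core

variable {ι : Type*} [DecidableEq ι] [AddCommMonoid ι]
variable {R : Type*} [CommRing R]

/-- `𝒜` is a grading of the ring `R` by the (torsionless) monoid `ι`:
the components multiply correctly and give an internal direct sum decomposition. -/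
structure IsGrRing (𝒜 : ι → AddSubgroup R) : Prop where
  one_mem : (1 : R) ∈ 𝒜 0
  mul_mem : ∀ {i j : ι} {a b : R}, a ∈ 𝒜 i → b ∈ 𝒜 j → a * b ∈ 𝒜 (i + j)
  internal : DirectSum.IsInternal 𝒜

/-- An ideal of `R` is homogeneous iff every element of it is a finite sum of
homogeneous elements of the ideal. -/
def IsHomIdeal (𝒜 : ι → AddSubgroup R) (I : Ideal R) : Prop :=
  ∀ x ∈ I, x ∈ AddSubmonoid.closure {y : R | SetLike.IsHomogeneousElem 𝒜 y ∧ y ∈ I}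

/-- A graded (homogeneous) maximal ideal: maximal among proper homogeneous ideals. -/
def IsGrMaxIdeal (𝒜 : ι → AddSubgroup R) (I : Ideal R) : Prop :=
  IsHomIdeal 𝒜 I ∧ I ≠ ⊤ ∧ ∀ J : Ideal R, IsHomIdeal 𝒜 J → I ≤ J → J ≠ ⊤ → J = I

/-- `R` is gr-local: it has exactly one graded maximal ideal. -/
def GrLocal (𝒜 : ι → AddSubgroup R) : Prop :=
  ∃! I : Ideal R, IsGrMaxIdeal 𝒜 I

/-- A prime ideal of height one (in a domain). -/
def HeightOnePrime (P : Ideal R) : Prop :=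
  P.IsPrime ∧ P ≠ ⊥ ∧ ∀ Q : Ideal R, Q.IsPrime → Q < P → Q = ⊥

variable [IsDomain R]

/-- A homogeneous element of the graded quotient field of `R`, i.e. a quotient of two
homogeneous elements of `R` (viewed inside the full quotient field). -/
def IsHomFrac (𝒜 : ι → AddSubgroup R) (x : FractionRing R) : Prop :=
  ∃ (i j : ι) (a b : R), a ∈ 𝒜 i ∧ b ∈ 𝒜 j ∧ b ≠ 0 ∧
    x * algebraMap R (FractionRing R) b = algebraMap R (FractionRing R) a

/-- `S` is a graded overring of `R`: a ring between `R` and the graded quotient field that is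
the sum of its homogeneous components, i.e. each of its elements is a finite sum of
homogeneous elements of `S`. -/
def IsGradedOverring (𝒜 : ι → AddSubgroup R) (S : Subalgebra R (FractionRing R)) : Prop :=
  ∀ x ∈ S, x ∈ AddSubmonoid.closure {y : FractionRing R | y ∈ S ∧ IsHomFrac 𝒜 y}

/-- A homogeneous ideal of an overring `S` of `R`. -/
def IsHomIdealOver (𝒜 : ι → AddSubgroup R) (S : Subalgebra R (FractionRing R))
    (I : Ideal S) : Prop :=
  ∀ x ∈ I, (x : FractionRing R) ∈ AddSubmonoid.closure
    {y : FractionRing R | IsHomFrac 𝒜 y ∧ ∃ h : y ∈ S, (⟨y, h⟩ : S) ∈ I}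

/-- A graded maximal ideal of an overring. -/
def IsGrMaxIdealOver (𝒜 : ι → AddSubgroup R) (S : Subalgebra R (FractionRing R))
    (I : Ideal S) : Prop :=
  IsHomIdealOver 𝒜 S I ∧ I ≠ ⊤ ∧
    ∀ J : Ideal S, IsHomIdealOver 𝒜 S J → I ≤ J → J ≠ ⊤ → J = I

/-- The overring `S` is gr-local. -/
def GrLocalOver (𝒜 : ι → AddSubgroup R) (S : Subalgebra R (FractionRing R)) : Prop :=
  ∃! I : Ideal S, IsGrMaxIdealOver 𝒜 S I

/-- `S` satisfies graded going-down (gGD) over `R`. -/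
def GGD (𝒜 : ι → AddSubgroup R) (S : Subalgebra R (FractionRing R)) : Prop :=
  ∀ (P Q : Ideal R) (Qt : Ideal S), P.IsPrime → Q.IsPrime → Qt.IsPrime →
    IsHomIdeal 𝒜 P → IsHomIdeal 𝒜 Q → IsHomIdealOver 𝒜 S Qt → P ≤ Q →
    Qt.comap (algebraMap R S) = Q →
    ∃ Pt : Ideal S, Pt.IsPrime ∧ IsHomIdealOver 𝒜 S Pt ∧ Pt ≤ Qt ∧
      Pt.comap (algebraMap R S) = P

/-- The overring `S` is a localization of `R` (at some multiplicative subset `W` of `R`). -/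
def IsLocalizationOfR (S : Subalgebra R (FractionRing R)) : Prop :=
  ∃ W : Submonoid R, (∀ w ∈ W, IsUnit (algebraMap R S w)) ∧
    ∀ s : S, ∃ (r w : R), w ∈ W ∧ s * algebraMap R S w = algebraMap R S r

/-- `R` is a graded perinormal domain: every gr-local graded overring satisfying gGD is a
localization of `R`. -/
def GradedPerinormal (𝒜 : ι → AddSubgroup R) : Prop :=
  ∀ S : Subalgebra R (FractionRing R),
    IsGradedOverring 𝒜 S → GrLocalOver 𝒜 S → GGD 𝒜 S → IsLocalizationOfR S

/-- `R` is a graded globally perinormal domain: every graded overring satisfying gGD is a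
localization of `R`. -/
def GradedGloballyPerinormal (𝒜 : ι → AddSubgroup R) : Prop :=
  ∀ S : Subalgebra R (FractionRing R),
    IsGradedOverring 𝒜 S → GGD 𝒜 S → IsLocalizationOfR S

/-- The homogeneous localization `R_(P)` of `R` at an ideal `P`: the subring of the graded
quotient field consisting of fractions with homogeneous denominator outside `P`. -/
def HomLocR (𝒜 : ι → AddSubgroup R) (P : Ideal R) : Subalgebra R (FractionRing R) :=
  Algebra.adjoin R {x : FractionRing R | ∃ a w : R, SetLike.IsHomogeneousElem 𝒜 w ∧ w ∉ P ∧
    x * algebraMap R (FractionRing R) w = algebraMap R (FractionRing R) a}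

/-- The homogeneous localization `S_(Q)` of an overring `S` at an ideal `Q` of `S`. -/
def HomLocOver (𝒜 : ι → AddSubgroup R) (S : Subalgebra R (FractionRing R)) (Q : Ideal S) :
    Subalgebra R (FractionRing R) :=
  Algebra.adjoin R {x : FractionRing R | ∃ s w : S, IsHomFrac 𝒜 (w : FractionRing R) ∧
    w ∉ Q ∧ x * (w : FractionRing R) = (s : FractionRing R)}

/-- The localization `R_W` of `R` at a multiplicative set `W`, as a subring of the quotient
field. -/
def LocW (W : Submonoid R) : Subalgebra R (FractionRing R) :=
  Algebra.adjoin R {x : FractionRing R | ∃ r : R, ∃ w ∈ W,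
    x * algebraMap R (FractionRing R) w = algebraMap R (FractionRing R) r}

/-- A subring `V` of the graded quotient field (containing `R`) is a gr-valuation domain:
for every nonzero homogeneous `x` of the graded quotient field, `x ∈ V` or `x⁻¹ ∈ V`. -/
def GrValuation (𝒜 : ι → AddSubgroup R) (V : Subalgebra R (FractionRing R)) : Prop :=
  ∀ x : FractionRing R, x ≠ 0 → IsHomFrac 𝒜 x → x ∈ V ∨ x⁻¹ ∈ V

/-- `R` is a gr-(R₁) domain: the homogeneous localization at every height-one homogeneous
prime is a gr-valuation domain. -/
def GrR1 (𝒜 : ι → AddSubgroup R) : Prop :=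
  ∀ P : Ideal R, HeightOnePrime P → IsHomIdeal 𝒜 P → GrValuation 𝒜 (HomLocR 𝒜 P)

/-- The ideal `I` of `T` is the contraction of the ideal `J` of `S` (that is, `I = J ∩ T`
inside the common quotient field). -/
def Contracts (T S : Subalgebra R (FractionRing R)) (J : Ideal S) (I : Ideal T) : Prop :=
  ∀ x : FractionRing R,
    (∃ h : x ∈ T, (⟨x, h⟩ : T) ∈ I) ↔ (x ∈ T ∧ ∃ h : x ∈ S, (⟨x, h⟩ : S) ∈ J)

/-- `S` satisfies graded going-down over the intermediate ring `T`. -/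
def GGDSub (𝒜 : ι → AddSubgroup R) (T S : Subalgebra R (FractionRing R)) : Prop :=
  ∀ (P Q : Ideal T) (Qt : Ideal S), P.IsPrime → Q.IsPrime → Qt.IsPrime →
    IsHomIdealOver 𝒜 T P → IsHomIdealOver 𝒜 T Q → IsHomIdealOver 𝒜 S Qt → P ≤ Q →
    Contracts T S Qt Q →
    ∃ Pt : Ideal S, Pt.IsPrime ∧ IsHomIdealOver 𝒜 S Pt ∧ Pt ≤ Qt ∧ Contracts T S Pt P

/-- `S` is a localization of the intermediate ring `T` at a multiplicative subset of `T`. -/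
def IsLocalizationOfSub (T S : Subalgebra R (FractionRing R)) : Prop :=
  ∃ W : Submonoid (FractionRing R), (W : Set (FractionRing R)) ⊆ T ∧
    (∀ w ∈ W, ∃ y ∈ S, w * y = 1) ∧ ∀ s ∈ S, ∃ t ∈ T, ∃ w ∈ W, s * w = t

/-- The intermediate ring `T` (e.g. a homogeneous localization of `R`) is a graded
perinormal domain. -/
def GradedPerinormalSub (𝒜 : ι → AddSubgroup R) (T : Subalgebra R (FractionRing R)) : Prop :=
  ∀ S : Subalgebra R (FractionRing R), T ≤ S → IsGradedOverring 𝒜 S → GrLocalOver 𝒜 S →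
    GGDSub 𝒜 T S → IsLocalizationOfSub T S

/-- The intermediate ring `T` is a graded globally perinormal domain. -/
def GradedGloballyPerinormalSub (𝒜 : ι → AddSubgroup R)
    (T : Subalgebra R (FractionRing R)) : Prop :=
  ∀ S : Subalgebra R (FractionRing R), T ≤ S → IsGradedOverring 𝒜 S →
    GGDSub 𝒜 T S → IsLocalizationOfSub T S

/-- `R` is a gr-essential domain: `R` is the intersection of homogeneous localizations at a
family of homogeneous primes, each of which is a gr-valuation domain. -/
def GrEssential (𝒜 : ι → AddSubgroup R) : Prop :=
  ∃ I : Set (Ideal R),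
    (∀ P ∈ I, P.IsPrime ∧ IsHomIdeal 𝒜 P ∧ GrValuation 𝒜 (HomLocR 𝒜 P)) ∧
    ((⊥ : Subalgebra R (FractionRing R)) : Set (FractionRing R)) =
      ⋂ P ∈ I, (HomLocR 𝒜 P : Set (FractionRing R))

/-- The intermediate ring `T` is a gr-essential domain. -/
def GrEssentialSub (𝒜 : ι → AddSubgroup R) (T : Subalgebra R (FractionRing R)) : Prop :=
  ∃ I : Set (Ideal T),
    (∀ P ∈ I, P.IsPrime ∧ IsHomIdealOver 𝒜 T P ∧ GrValuation 𝒜 (HomLocOver 𝒜 T P)) ∧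
    (T : Set (FractionRing R)) = ⋂ P ∈ I, (HomLocOver 𝒜 T P : Set (FractionRing R))

end Core

section LinearOrder

open TensorProduct in
/-- Every torsion-free abelian group admits a translation-invariant linear order. -/
theorem exists_linearOrder_of_isAddTorsionFree (G : Type*) [AddCommGroup G] [IsAddTorsionFree G] :
    ∃ _ : LinearOrder G, IsOrderedCancelAddMonoid G := by
  let B := Module.Basis.ofVectorSpace ℚ (ℚ ⊗[ℤ] G)
  let : LinearOrder (Module.Basis.ofVectorSpaceIndex ℚ (ℚ ⊗[ℤ] G)) :=
    IsWellOrder.linearOrder WellOrderingRel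
  let f : G → Lex (Module.Basis.ofVectorSpaceIndex ℚ (ℚ ⊗[ℤ] G) →₀ ℚ) :=
    fun g ↦ toLex (B.repr (1 ⊗ₜ g))
  have hinj : Function.Injective f := by
    refine toLex.injective.comp (B.repr.injective.comp fun a b hab ↦ ?_)
    have h := Module.Flat.rTensor_preserves_injective_linearMap (M := G)
      (Algebra.linearMap ℤ ℚ) (algebraMap ℤ ℚ).injective_int
    have := @h (1 ⊗ₜ a) (1 ⊗ₜ b) (by simpa using hab)
    simpa using congrArg (TensorProduct.lid ℤ G) this
  have hadd : ∀ a b, f (a + b) = f a + f b := fun a b ↦ by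
    simp [f, TensorProduct.tmul_add]
  let := LinearOrder.lift' f hinj
  refine ⟨inferInstance, Function.Injective.isOrderedCancelAddMonoid f hadd .rfl⟩

/-- A proper homogeneous ideal that is prime with respect to homogeneous elements is prime, when
the grading group is torsion-free. -/
theorem Ideal.IsHomogeneous.isPrime_of_isAddTorsionFree {G A : Type*} [AddCommGroup G]
    [IsAddTorsionFree G] [dec : DecidableEq G] [CommRing A] {ℬ : G → AddSubgroup A} [GradedRing ℬ]
    {I : Ideal A} (hI : I.IsHomogeneous ℬ) (hI' : I ≠ ⊤)
    (h : ∀ {x y : A}, SetLike.IsHomogeneousElem ℬ x → SetLike.IsHomogeneousElem ℬ y →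
      x * y ∈ I → x ∈ I ∨ y ∈ I) : I.IsPrime := by
  obtain ⟨l, _⟩ := exists_linearOrder_of_isAddTorsionFree G
  obtain rfl : dec = l.toDecidableEq := Subsingleton.elim _ _
  exact hI.isPrime_of_homogeneous_mem_or_mem hI' h

end LinearOrder

section GradedMaximal

variable {G A : Type*} [AddCommGroup G] [DecidableEq G] [CommRing A] {ℬ : G → AddSubgroup A}
  [GradedRing ℬ]

/-- An ideal maximal among the proper homogeneous ideals is prime. -/
theorem Ideal.IsHomogeneous.isPrime_of_maximal [IsAddTorsionFree G] {I : Ideal A}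
    (hI : I.IsHomogeneous ℬ) (hI' : I ≠ ⊤)
    (hmax : ∀ J : Ideal A, J.IsHomogeneous ℬ → I ≤ J → J ≠ ⊤ → J = I) : I.IsPrime := by
  refine hI.isPrime_of_isAddTorsionFree hI' fun {x y} hx _ hxy ↦ or_iff_not_imp_left.2 fun hxI ↦ ?_
  have htop : I ⊔ Ideal.span {x} = ⊤ := by
    by_contra hne
    refine hxI ?_
    rw [← hmax _ (hI.sup (Ideal.homogeneous_span ℬ _ (by simpa using hx))) le_sup_left hne]
    exact Ideal.mem_sup_right (Ideal.mem_span_singleton_self x)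
  obtain ⟨m, hm, z, hz, h1⟩ := Submodule.mem_sup.1 (htop ▸ Submodule.mem_top : (1 : A) ∈ _)
  obtain ⟨c, rfl⟩ := Ideal.mem_span_singleton'.1 hz
  have : y = m * y + c * (x * y) := by rw [← mul_assoc, ← add_mul, h1, one_mul]
  rw [this]
  exact I.add_mem (I.mul_mem_right _ hm) (I.mul_mem_left _ hxy)

/-- A proper homogeneous ideal is contained in an ideal maximal among the proper homogeneous
ideals. -/
theorem Ideal.IsHomogeneous.exists_le_maximal {I : Ideal A} (hI : I.IsHomogeneous ℬ)
    (hI' : I ≠ ⊤) :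
    ∃ M : Ideal A, I ≤ M ∧ M.IsHomogeneous ℬ ∧ M ≠ ⊤ ∧
      ∀ J : Ideal A, J.IsHomogeneous ℬ → M ≤ J → J ≠ ⊤ → J = M := by
  obtain ⟨M, hIM, hM⟩ := zorn_le_nonempty₀ {J : Ideal A | J.IsHomogeneous ℬ ∧ J ≠ ⊤} (by
    intro c hc hchain J hJ
    refine ⟨SupSet.sSup c, ⟨Ideal.IsHomogeneous.sSup fun K hK ↦ (hc hK).1, ?_⟩, fun K hK ↦ le_sSup hK⟩
    rw [Ideal.ne_top_iff_one]
    intro h1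
    obtain ⟨K, hK, h1K⟩ := (Submodule.mem_sSup_of_directed ⟨J, hJ⟩ hchain.directedOn).1 h1
    exact (hc hK).2 ((Ideal.eq_top_iff_one K).2 h1K)) I ⟨hI, hI'⟩
  exact ⟨M, hIM, hM.prop.1, hM.prop.2, fun J hJ hMJ hJ' ↦ (hM.le_of_ge ⟨hJ, hJ'⟩ hMJ).antisymm hMJ⟩

end GradedMaximal

section Denominators

variable {R : Type*} [CommRing R]

/-- The ideal `(R :_R x)` of denominators of an element `x` of the quotient field. -/
def denominatorIdeal (x : FractionRing R) : Ideal R :=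
  (1 : Submodule R (FractionRing R)).comap (LinearMap.toSpanSingleton R (FractionRing R) x)

theorem mem_denominatorIdeal {x : FractionRing R} {r : R} :
    r ∈ denominatorIdeal x ↔
      ∃ c : R, x * algebraMap R (FractionRing R) r = algebraMap R (FractionRing R) c := by
  simp [denominatorIdeal, Submodule.mem_one, Algebra.smul_def, mul_comm, eq_comm]

theorem map_denominatorIdeal_add_eq_top {S : Subalgebra R (FractionRing R)} {x y : FractionRing R}
    (hx : (denominatorIdeal x).map (algebraMap R S) = ⊤)
    (hy : (denominatorIdeal y).map (algebraMap R S) = ⊤) :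
    (denominatorIdeal (x + y)).map (algebraMap R S) = ⊤ := by
  have hle : denominatorIdeal x * denominatorIdeal y ≤ denominatorIdeal (x + y) := by
    intro r hr
    obtain ⟨a, ha⟩ := mem_denominatorIdeal.1 (Ideal.mul_le_left hr)
    obtain ⟨b, hb⟩ := mem_denominatorIdeal.1 (Ideal.mul_le_right hr)
    exact mem_denominatorIdeal.2 ⟨a + b, by rw [map_add, add_mul, ha, hb]⟩
  rw [eq_top_iff, ← Ideal.top_mul ⊤]
  nth_rewrite 1 [← hx]
  rw [← hy, ← Ideal.map_mul]
  exact Ideal.map_mono hle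

/-- An overring each of whose elements has denominators generating the unit ideal is flat. -/
theorem flat_of_map_denominatorIdeal_eq_top (S : Subalgebra R (FractionRing R))
    (h : ∀ s : S, (denominatorIdeal (s : FractionRing R)).map (algebraMap R S) = ⊤) :
    Module.Flat R S := by
  refine Module.Flat.of_forall_isTrivialRelation fun {l f x} hfx ↦ ?_
  have htop : (⨅ i, denominatorIdeal (x i : FractionRing R)).map (algebraMap R S) = ⊤ := by
    rw [eq_top_iff]
    calc (⊤ : Ideal S)
        = ∏ i, (denominatorIdeal (x i : FractionRing R)).map (algebraMap R S) := by
          simp [h, ← Ideal.one_eq_top]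
      _ = (∏ i, denominatorIdeal (x i : FractionRing R)).map (algebraMap R S) :=
          (map_prod (Ideal.mapHom (algebraMap R S)) _ _).symm
      _ ≤ _ := Ideal.map_mono (Ideal.prod_le_inf.trans (Finset.inf_univ_eq_iInf _).le)
  have h1 : (1 : S) ∈ Submodule.span S
      (algebraMap R S '' (⨅ i, denominatorIdeal (x i : FractionRing R) : Ideal R)) :=
    (Ideal.eq_top_iff_one _).1 htop
  obtain ⟨k, y, r, hr⟩ := Submodule.mem_span_set'.1 h1
  choose w hw hwr using fun j ↦ (r j).2
  have hwx : ∀ i j, ∃ c : R, (x i : FractionRing R) * algebraMap R (FractionRing R) (w j) =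
      algebraMap R (FractionRing R) c :=
    fun i j ↦ mem_denominatorIdeal.1 ((Submodule.mem_iInf _).1 (hw j) i)
  choose c hc using hwx
  refine ⟨k, c, y, fun i ↦ ?_, fun j ↦ ?_⟩
  · have hcx : ∀ j, algebraMap R S (c i j) = x i * algebraMap R S (w j) :=
      fun j ↦ Subtype.ext (hc i j).symm
    simp_rw [Algebra.smul_def, hcx, hwr, mul_assoc, ← Finset.mul_sum]
    simp only [smul_eq_mul] at hr
    simp_rw [mul_comm _ (y _), hr, mul_one]
  · apply IsFractionRing.injective R (FractionRing R)
    have := congrArg (fun z : S ↦ (z : FractionRing R)) hfx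
    simp only [Algebra.smul_def, AddSubmonoidClass.coe_finsetSum, MulMemClass.coe_mul] at this
    simp only [map_sum, map_mul, ← hc, map_zero, ← mul_assoc, ← Finset.sum_mul]
    exact mul_eq_zero_of_left this _

variable [IsDomain R]

/-- If an overring is flat, then each of its elements has denominators generating the unit
ideal. -/
theorem map_denominatorIdeal_eq_top_of_flat (S : Subalgebra R (FractionRing R))
    [Module.Flat R S] (s : S) :
    (denominatorIdeal (s : FractionRing R)).map (algebraMap R S) = ⊤ := by
  obtain ⟨a, b, hb, hab⟩ := IsFractionRing.div_surjective (A := R) (s : FractionRing R)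
  have hb0 : algebraMap R (FractionRing R) b ≠ 0 :=
    IsFractionRing.to_map_ne_zero_of_mem_nonZeroDivisors hb
  have hs : (s : FractionRing R) * algebraMap R (FractionRing R) b =
      algebraMap R (FractionRing R) a := by rw [← hab, div_mul_cancel₀ _ hb0]
  obtain ⟨k, c, y, hy, hc⟩ := Module.Flat.isTrivialRelation_of_sum_smul_eq_zero
    (f := ![b, -a]) (x := ![s, 1]) (by
      ext; simp [Algebra.smul_def, ← hs, mul_comm])
  rw [Ideal.eq_top_iff_one]
  have h1 : (1 : S) = ∑ j, c 1 j • y j := by simpa using hy 1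
  rw [h1]
  refine Ideal.sum_mem _ fun j _ ↦ ?_
  rw [Algebra.smul_def]
  refine Ideal.mul_mem_right _ _ (Ideal.mem_map_of_mem _ (mem_denominatorIdeal.2 ⟨c 0 j, ?_⟩))
  have hj : b * c 0 j = a * c 1 j := by
    have := hc j
    simp only [Fin.sum_univ_two, Matrix.cons_val_zero, Matrix.cons_val_one] at this
    linear_combination this
  apply mul_right_cancel₀ hb0
  have := congrArg (algebraMap R (FractionRing R)) hj
  simp only [map_mul] at this
  linear_combination algebraMap R (FractionRing R) (c 1 j) * hs - this

end Denominators

section Overring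

variable {G R : Type*} [AddCommGroup G] [DecidableEq G] [CommRing R] [IsDomain R]
  (𝒜 : G → AddSubgroup R) [GradedRing 𝒜] (S : Subalgebra R (FractionRing R))

/-- The degree `g` component of an overring `S`: the elements of `S` that are quotients of
homogeneous elements of `R` whose degrees differ by `g`. -/
def overringComponent (g : G) : AddSubgroup S where
  carrier := {s | ∃ j, ∃ b ∈ 𝒜 j, b ≠ 0 ∧ ∃ a ∈ 𝒜 (g + j),
    (s : FractionRing R) * algebraMap R (FractionRing R) b = algebraMap R (FractionRing R) a}
  zero_mem' := ⟨0, 1, SetLike.one_mem_graded 𝒜, one_ne_zero, 0, zero_mem _, by simp⟩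
  add_mem' := by
    rintro s t ⟨j, b, hb, hb0, a, ha, hs⟩ ⟨k, c, hc, hc0, d, hd, ht⟩
    refine ⟨j + k, b * c, SetLike.mul_mem_graded hb hc, mul_ne_zero hb0 hc0, a * c + d * b,
      add_mem ?_ ?_, ?_⟩
    · exact add_assoc g j k ▸ SetLike.mul_mem_graded ha hc
    · exact (by abel : g + k + j = g + (j + k)) ▸ SetLike.mul_mem_graded hd hb
    · simp only [AddMemClass.coe_add, map_mul, map_add, ← hs, ← ht]
      ring
  neg_mem' := by
    rintro s ⟨j, b, hb, hb0, a, ha, hs⟩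
    exact ⟨j, b, hb, hb0, -a, neg_mem ha, by simp [hs]⟩

instance overringComponent.gradedMonoid : SetLike.GradedMonoid (overringComponent 𝒜 S) where
  one_mem := ⟨0, 1, SetLike.one_mem_graded 𝒜, one_ne_zero, 1,
    (add_zero (0 : G)).symm ▸ SetLike.one_mem_graded 𝒜, by simp⟩
  mul_mem := by
    rintro g h s t ⟨j, b, hb, hb0, a, ha, hs⟩ ⟨k, c, hc, hc0, d, hd, ht⟩
    refine ⟨j + k, b * c, SetLike.mul_mem_graded hb hc, mul_ne_zero hb0 hc0, a * d,
      add_add_add_comm g j h k ▸ SetLike.mul_mem_graded ha hd, ?_⟩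
    simp only [MulMemClass.coe_mul, map_mul, ← hs, ← ht]
    ring

variable {S}

theorem isHomFrac_iff_isHomogeneousElem {s : S} :
    IsHomFrac 𝒜 (s : FractionRing R) ↔
      SetLike.IsHomogeneousElem (overringComponent 𝒜 S) s := by
  constructor
  · rintro ⟨i, j, a, b, ha, hb, hb0, h⟩
    exact ⟨i - j, j, b, hb, hb0, a, by rwa [sub_add_cancel], h⟩
  · rintro ⟨g, j, b, hb, hb0, a, ha, h⟩
    exact ⟨g + j, j, a, b, ha, hb, hb0, h⟩

variable {𝒜} in
theorem algebraMap_mem_overringComponent {g : G} {r : R} (hr : r ∈ 𝒜 g) :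
    algebraMap R S r ∈ overringComponent 𝒜 S g :=
  ⟨0, 1, SetLike.one_mem_graded 𝒜, one_ne_zero, r, (add_zero g).symm ▸ hr, by
    simp⟩

/-- Finitely many homogeneous elements of an overring have a common homogeneous denominator. -/
theorem exists_common_homogeneous_denominator (x : ∀ g, overringComponent 𝒜 S g) (T : Finset G) :
    ∃ e, ∃ d ∈ 𝒜 e, d ≠ 0 ∧ ∀ g ∈ T, ∃ a ∈ 𝒜 (g + e),
      ((x g : S) : FractionRing R) * algebraMap R (FractionRing R) d =
        algebraMap R (FractionRing R) a := by
  induction T using Finset.induction_on with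
  | empty => exact ⟨0, 1, SetLike.one_mem_graded 𝒜, one_ne_zero, by simp⟩
  | insert g T _ ih =>
    obtain ⟨e, d, hd, hd0, hT⟩ := ih
    obtain ⟨j, b, hb, hb0, a, ha, hab⟩ := (x g).2
    refine ⟨j + e, b * d, SetLike.mul_mem_graded hb hd, mul_ne_zero hb0 hd0, fun k hk ↦ ?_⟩
    rcases Finset.mem_insert.1 hk with rfl | hk
    · refine ⟨a * d, add_assoc k j e ▸ SetLike.mul_mem_graded ha hd, ?_⟩
      rw [map_mul, map_mul, ← hab, mul_assoc]
    · obtain ⟨c, hc, hcd⟩ := hT k hk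
      refine ⟨b * c, (by abel : j + (k + e) = k + (j + e)) ▸ SetLike.mul_mem_graded hb hc, ?_⟩
      rw [map_mul, map_mul, ← hcd]
      ring

theorem overringComponent_isInternal (hS : IsGradedOverring 𝒜 S) :
    DirectSum.IsInternal (overringComponent 𝒜 S) := by
  classical
  constructor
  · rw [injective_iff_map_eq_zero]
    intro x hx
    obtain ⟨e, d, hd, hd0, h⟩ :=
      exists_common_homogeneous_denominator 𝒜 (fun g ↦ x g) (DFinsupp.support x)
    choose! a ha hax using h
    have hd0' : algebraMap R (FractionRing R) d ≠ 0 := by simpa using hd0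
    have hsum : ∑ g ∈ DFinsupp.support x, a g = 0 := by
      apply IsFractionRing.injective R (FractionRing R)
      rw [map_sum, map_zero, ← Finset.sum_congr rfl hax, ← Finset.sum_mul]
      rw [DirectSum.coeAddMonoidHom_eq_dfinsuppSum] at hx
      have := congrArg (fun z : S ↦ (z : FractionRing R)) hx
      simp only [DFinsupp.sum, AddSubmonoidClass.coe_finsetSum, ZeroMemClass.coe_zero] at this
      rw [this, zero_mul]
    refine DFinsupp.ext fun g ↦ ?_
    by_contra hg
    have hgs : g ∈ DFinsupp.support x := DFinsupp.mem_support_iff.2 hg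
    have hag : a g = 0 := by
      have := congrArg (GradedRing.proj 𝒜 (g + e)) hsum
      simp only [map_sum, map_zero, GradedRing.proj_apply] at this
      rw [Finset.sum_eq_single_of_mem g hgs, DirectSum.decompose_of_mem_same 𝒜 (ha g hgs)] at this
      · exact this
      · intro k hk hkg
        exact DirectSum.decompose_of_mem_ne 𝒜 (ha k hk) fun h ↦ hkg (add_right_cancel h)
    have := hax g hgs
    rw [hag, map_zero, mul_eq_zero, or_iff_left hd0'] at this
    exact hg (Subtype.ext (Subtype.ext this))
  · intro s
    have hle : AddSubmonoid.closure {y : FractionRing R | y ∈ S ∧ IsHomFrac 𝒜 y} ≤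
        AddMonoidHom.mrange ((S.val : S →+ FractionRing R).comp
          (DirectSum.coeAddMonoidHom (overringComponent 𝒜 S))) := by
      rw [AddSubmonoid.closure_le]
      rintro y ⟨hy, hyh⟩
      obtain ⟨g, hg⟩ := (isHomFrac_iff_isHomogeneousElem 𝒜 (s := ⟨y, hy⟩)).1 hyh
      exact ⟨DirectSum.of (fun g ↦ overringComponent 𝒜 S g) g ⟨⟨y, hy⟩, hg⟩, by simp⟩
    obtain ⟨x, hx⟩ := hle (hS s s.2)
    exact ⟨x, Subtype.ext hx⟩

/-- A graded overring is a graded ring. -/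
@[reducible] noncomputable def IsGradedOverring.gradedRing (hS : IsGradedOverring 𝒜 S) :
    GradedRing (overringComponent 𝒜 S) where
  toGradedMonoid := overringComponent.gradedMonoid 𝒜 S
  toDecomposition := (overringComponent_isInternal 𝒜 hS).chooseDecomposition

theorem isHomIdealOver_iff [GradedRing (overringComponent 𝒜 S)] {I : Ideal S} :
    IsHomIdealOver 𝒜 S I ↔ I.IsHomogeneous (overringComponent 𝒜 S) := by
  classical
  constructor
  · intro h g x hx
    let proj : S →+ S := GradedRing.proj (overringComponent 𝒜 S) g
    have hle : AddSubmonoid.closure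
        {y : FractionRing R | IsHomFrac 𝒜 y ∧ ∃ h : y ∈ S, (⟨y, h⟩ : S) ∈ I} ≤
        (I.toAddSubmonoid.comap proj).map (S.val : S →+ FractionRing R) := by
      rw [AddSubmonoid.closure_le]
      rintro y ⟨hyh, hy, hyI⟩
      refine ⟨⟨y, hy⟩, ?_, rfl⟩
      obtain ⟨k, hk⟩ := (isHomFrac_iff_isHomogeneousElem 𝒜 (s := ⟨y, hy⟩)).1 hyh
      change ((DirectSum.decompose (overringComponent 𝒜 S) (⟨y, hy⟩ : S) g : S)) ∈ I
      rw [DirectSum.decompose_of_mem _ hk, DirectSum.coe_of_apply]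
      split_ifs
      exacts [hyI, I.zero_mem]
    obtain ⟨z, hz, hzx⟩ := hle (h x hx)
    obtain rfl : z = x := Subtype.ext hzx
    exact hz
  · intro h x hx
    rw [← DirectSum.sum_support_decompose (overringComponent 𝒜 S) x,
      AddSubmonoidClass.coe_finsetSum]
    exact sum_mem fun g _ ↦ AddSubmonoid.subset_closure
      ⟨(isHomFrac_iff_isHomogeneousElem 𝒜).2 ⟨g, SetLike.coe_mem _⟩, SetLike.coe_mem _, h g hx⟩

theorem isGrMaxIdealOver_iff [GradedRing (overringComponent 𝒜 S)] {I : Ideal S} :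
    IsGrMaxIdealOver 𝒜 S I ↔ I.IsHomogeneous (overringComponent 𝒜 S) ∧ I ≠ ⊤ ∧
      ∀ J : Ideal S, J.IsHomogeneous (overringComponent 𝒜 S) → I ≤ J → J ≠ ⊤ → J = I := by
  simp only [IsGrMaxIdealOver, isHomIdealOver_iff]

theorem IsGrMaxIdealOver.isPrime [IsAddTorsionFree G] (hS : IsGradedOverring 𝒜 S) {I : Ideal S}
    (hI : IsGrMaxIdealOver 𝒜 S I) : I.IsPrime := by
  let := hS.gradedRing
  obtain ⟨hhom, hne, hmax⟩ := (isGrMaxIdealOver_iff 𝒜).1 hI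
  exact hhom.isPrime_of_maximal hne hmax

end Overring

section Localization

variable {G R : Type*} [AddCommGroup G] [DecidableEq G] [CommRing R]
  {𝒜 : G → AddSubgroup R} [GradedRing 𝒜]

theorem mem_homLocR_iff {P : Ideal R} [P.IsPrime] {x : FractionRing R} :
    x ∈ HomLocR 𝒜 P ↔ ∃ a w : R, SetLike.IsHomogeneousElem 𝒜 w ∧ w ∉ P ∧
      x * algebraMap R (FractionRing R) w = algebraMap R (FractionRing R) a := by
  refine ⟨fun hx ↦ ?_, fun hx ↦ Algebra.subset_adjoin hx⟩
  induction hx using Algebra.adjoin_induction with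
  | mem x hx => exact hx
  | algebraMap r =>
    exact ⟨r, 1, ⟨0, SetLike.one_mem_graded 𝒜⟩, P.one_notMem, by simp⟩
  | add x y _ _ hx hy =>
    obtain ⟨a, w, hw, hwP, hx⟩ := hx
    obtain ⟨b, v, hv, hvP, hy⟩ := hy
    refine ⟨a * v + b * w, w * v, SetLike.IsHomogeneousElem.mul hw hv,
      ‹P.IsPrime›.mul_notMem hwP hvP, ?_⟩
    simp only [map_mul, map_add, ← hx, ← hy]
    ring
  | mul x y _ _ hx hy =>
    obtain ⟨a, w, hw, hwP, hx⟩ := hx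
    obtain ⟨b, v, hv, hvP, hy⟩ := hy
    refine ⟨a * b, w * v, SetLike.IsHomogeneousElem.mul hw hv,
      ‹P.IsPrime›.mul_notMem hwP hvP, ?_⟩
    simp only [map_mul, ← hx, ← hy]
    ring

variable [IsDomain R] {S : Subalgebra R (FractionRing R)}

/-- The denominator ideal of a homogeneous fraction is homogeneous. -/
theorem denominatorIdeal_isHomogeneous {x : FractionRing R} (hx : IsHomFrac 𝒜 x) :
    (denominatorIdeal x).IsHomogeneous 𝒜 := by
  obtain ⟨i, j, a, b, ha, hb, hb0, hab⟩ := hx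
  intro k r hr
  obtain ⟨c, hc⟩ := mem_denominatorIdeal.1 hr
  have hb0' : algebraMap R (FractionRing R) b ≠ 0 := by simpa using hb0
  have hrac : r * a = c * b := by
    apply IsFractionRing.injective R (FractionRing R)
    rw [map_mul, map_mul, ← hab, ← hc]
    ring
  have hk := congrArg (fun z ↦ (DirectSum.decompose 𝒜 z (k + i) : R)) hrac
  simp only [DirectSum.coe_decompose_mul_add_of_right_mem 𝒜 ha] at hk
  rw [← sub_add_cancel (k + i) j, DirectSum.coe_decompose_mul_add_of_right_mem 𝒜 hb] at hk
  refine mem_denominatorIdeal.2 ⟨DirectSum.decompose 𝒜 c (k + i - j), mul_right_cancel₀ hb0' ?_⟩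
  rw [← map_mul, ← hk, map_mul, ← hab]
  ring

theorem isHomogeneousElem_of_mul_mem {c b : R} {i j : G} (hb : b ∈ 𝒜 j) (hb0 : b ≠ 0)
    (hcb : c * b ∈ 𝒜 i) : SetLike.IsHomogeneousElem 𝒜 c := by
  refine ⟨i - j, ?_⟩
  have h := DirectSum.coe_decompose_mul_add_of_right_mem 𝒜 (a := c) (i := i - j) hb
  rw [sub_add_cancel, DirectSum.decompose_of_mem_same 𝒜 hcb] at h
  rw [mul_right_cancel₀ hb0 h]
  exact SetLike.coe_mem _

theorem homLocR_comap_le_homLocOver (Q : Ideal S) :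
    HomLocR 𝒜 (Q.comap (algebraMap R S)) ≤ HomLocOver 𝒜 S Q := by
  refine Algebra.adjoin_mono ?_
  rintro x ⟨a, w, ⟨g, hw⟩, hwQ, hx⟩
  exact ⟨algebraMap R S a, algebraMap R S w,
    (isHomFrac_iff_isHomogeneousElem 𝒜).2 ⟨g, algebraMap_mem_overringComponent hw⟩, hwQ, hx⟩

theorem le_homLocOver {Q : Ideal S} (hQ : Q ≠ ⊤) : S ≤ HomLocOver 𝒜 S Q := fun s hs ↦
  Algebra.subset_adjoin ⟨⟨s, hs⟩, 1, ⟨0, 0, 1, 1, SetLike.one_mem_graded 𝒜,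
    SetLike.one_mem_graded 𝒜, one_ne_zero, by simp⟩, (Ideal.ne_top_iff_one Q).1 hQ, by simp⟩

/-- If the denominators of a homogeneous element of an overring generate the unit ideal, then some
homogeneous denominator avoids a given proper ideal. -/
theorem exists_homogeneous_denominator_notMem {s : S} (hs : IsHomFrac 𝒜 (s : FractionRing R))
    (htop : (denominatorIdeal (s : FractionRing R)).map (algebraMap R S) = ⊤) {Q : Ideal S}
    (hQ : Q ≠ ⊤) :
    ∃ r : R, SetLike.IsHomogeneousElem 𝒜 r ∧ r ∉ Q.comap (algebraMap R S) ∧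
      r ∈ denominatorIdeal (s : FractionRing R) := by
  classical
  by_contra! h
  refine hQ (top_le_iff.1 (htop ▸ Ideal.map_le_iff_le_comap.2 fun r hr ↦ ?_))
  rw [← DirectSum.sum_support_decompose 𝒜 r]
  refine Ideal.sum_mem _ fun g _ ↦ ?_
  by_contra hg
  exact h _ ⟨g, SetLike.coe_mem _⟩ hg (denominatorIdeal_isHomogeneous hs g hr)

theorem homLocOver_eq_homLocR_of_flat [Module.Flat R S] (hS : IsGradedOverring 𝒜 S)
    (Q : Ideal S) [hQ : Q.IsPrime] :
    HomLocOver 𝒜 S Q = HomLocR 𝒜 (Q.comap (algebraMap R S)) := by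
  refine le_antisymm ?_ (homLocR_comap_le_homLocOver Q)
  have hSle : ∀ s ∈ S, s ∈ HomLocR 𝒜 (Q.comap (algebraMap R S)) := by
    intro s hs
    have hle : AddSubmonoid.closure {y : FractionRing R | y ∈ S ∧ IsHomFrac 𝒜 y} ≤
        (HomLocR 𝒜 (Q.comap (algebraMap R S))).toSubmodule.toAddSubmonoid := by
      rw [AddSubmonoid.closure_le]
      rintro y ⟨hy, hyh⟩
      obtain ⟨r, hr, hrQ, hry⟩ := exists_homogeneous_denominator_notMem (s := ⟨y, hy⟩) hyh
        (map_denominatorIdeal_eq_top_of_flat S _) hQ.ne_top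
      obtain ⟨c, hc⟩ := mem_denominatorIdeal.1 hry
      exact Algebra.subset_adjoin ⟨c, r, hr, hrQ, hc⟩
    exact hle (hS s hs)
  refine Algebra.adjoin_le ?_
  rintro x ⟨s, w, hw, hwQ, hx⟩
  obtain ⟨r, ⟨g, hr⟩, hrQ, hrw⟩ := exists_homogeneous_denominator_notMem hw
    (map_denominatorIdeal_eq_top_of_flat S w) hQ.ne_top
  obtain ⟨c, hc⟩ := mem_denominatorIdeal.1 hrw
  obtain ⟨i, j, a, b, ha, hb, hb0, hab⟩ := hw
  have hch : SetLike.IsHomogeneousElem 𝒜 c := by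
    refine isHomogeneousElem_of_mul_mem hb hb0 (i := i + g) ?_
    convert SetLike.mul_mem_graded ha hr using 1
    apply IsFractionRing.injective R (FractionRing R)
    rw [map_mul, map_mul, ← hc, ← hab]
    ring
  have hcw : algebraMap R S c = w * algebraMap R S r := Subtype.ext hc.symm
  have hcQ : c ∉ Q.comap (algebraMap R S) := by
    rw [Ideal.mem_comap, hcw]
    exact hQ.mul_notMem hwQ hrQ
  have hc0 : algebraMap R (FractionRing R) c ≠ 0 := by
    rw [Ne, FaithfulSMul.algebraMap_eq_zero_iff]
    rintro rfl
    exact hcQ (Ideal.zero_mem _)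
  have hxc : x = s * (algebraMap R (FractionRing R) r / algebraMap R (FractionRing R) c) := by
    rw [← mul_div_assoc, eq_div_iff hc0, ← hc, ← hx]
    ring
  rw [hxc]
  exact mul_mem (hSle s s.2) (Algebra.subset_adjoin ⟨r, c, hch, hcQ, div_mul_cancel₀ _ hc0⟩)

/-- An overring all of whose homogeneous localizations at graded maximal ideals are homogeneous
localizations of the base ring is flat. -/
theorem flat_of_homLocOver_eq_homLocR [IsAddTorsionFree G] (hS : IsGradedOverring 𝒜 S)
    (h : ∀ Q : Ideal S, IsGrMaxIdealOver 𝒜 S Q →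
      HomLocOver 𝒜 S Q = HomLocR 𝒜 (Q.comap (algebraMap R S))) :
    Module.Flat R S := by
  let := hS.gradedRing
  refine flat_of_map_denominatorIdeal_eq_top S fun s ↦ ?_
  have hs := hS s s.2
  generalize (s : FractionRing R) = y at hs ⊢
  induction hs using AddSubmonoid.closure_induction with
  | zero =>
    have h0 : denominatorIdeal (0 : FractionRing R) = ⊤ :=
      (Ideal.eq_top_iff_one _).2 (mem_denominatorIdeal.2 ⟨0, by simp⟩)
    rw [h0, Ideal.map_top]
  | add x y _ _ hx hy => exact map_denominatorIdeal_add_eq_top hx hy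
  | mem y hy =>
    let J : Ideal S := Ideal.span
      (algebraMap R S '' {r | SetLike.IsHomogeneousElem 𝒜 r ∧ r ∈ denominatorIdeal y})
    have hJ : J.IsHomogeneous (overringComponent 𝒜 S) := by
      refine Ideal.homogeneous_span _ _ ?_
      rintro _ ⟨r, ⟨⟨g, hr⟩, _⟩, rfl⟩
      exact ⟨g, algebraMap_mem_overringComponent hr⟩
    by_contra hne
    have hJne : J ≠ ⊤ := fun hJtop ↦ hne <| top_le_iff.1 <|
      hJtop ▸ Ideal.span_mono (Set.image_mono fun r hr ↦ hr.2)
    obtain ⟨M, hJM, hM⟩ := hJ.exists_le_maximal hJne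
    have hM' : IsGrMaxIdealOver 𝒜 S M := (isGrMaxIdealOver_iff 𝒜).2 hM
    have := hM'.isPrime 𝒜 hS
    have hyM : y ∈ HomLocR 𝒜 (M.comap (algebraMap R S)) := h M hM' ▸ le_homLocOver hM.2.1 hy.1
    obtain ⟨a, w, hw, hwM, hya⟩ := mem_homLocR_iff.1 hyM
    exact hwM (hJM (Ideal.subset_span ⟨w, ⟨hw, mem_denominatorIdeal.2 ⟨a, hya⟩⟩, rfl⟩))

/-- A grading in the sense of `IsGrRing` is a `GradedRing`. -/
@[reducible] noncomputable def IsGrRing.gradedRing {G R : Type*} [AddCommGroup G] [DecidableEq G]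
    [CommRing R] {𝒜 : G → AddSubgroup R} (h : IsGrRing 𝒜) : GradedRing 𝒜 where
  one_mem := h.one_mem
  mul_mem _ _ _ _ := h.mul_mem
  toDecomposition := h.internal.chooseDecomposition

end Localization

/-- graded version of Richman's flatness criterion. Let `R` be a `G`-graded
domain and `S` a graded overring of `R`. The following are equivalent: (1) `S` is flat as an
`R`-module; (2) `S_(𝔭) = R_(𝔭 ∩ R)` for every homogeneous prime `𝔭` of `S`;
(3) `S_(𝔫) = R_(𝔫 ∩ R)` for every graded maximal ideal `𝔫` of `S`. -/
theorem flat_iff_homLoc_eq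
    {G : Type*} [DecidableEq G] [AddCommGroup G] (hG : ∀ g : G, g ≠ 0 → ¬IsOfFinAddOrder g)
    {R : Type*} [CommRing R] [IsDomain R]
    (𝒜 : G → AddSubgroup R) (hGr : IsGrRing 𝒜)
    (S : Subalgebra R (FractionRing R)) (hS : IsGradedOverring 𝒜 S) :
    (Module.Flat R S ↔
        ∀ 𝔭 : Ideal S, 𝔭.IsPrime → IsHomIdealOver 𝒜 S 𝔭 →
          HomLocOver 𝒜 S 𝔭 = HomLocR 𝒜 (𝔭.comap (algebraMap R S))) ∧
    ((∀ 𝔭 : Ideal S, 𝔭.IsPrime → IsHomIdealOver 𝒜 S 𝔭 →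
          HomLocOver 𝒜 S 𝔭 = HomLocR 𝒜 (𝔭.comap (algebraMap R S))) ↔
        ∀ 𝔫 : Ideal S, IsGrMaxIdealOver 𝒜 S 𝔫 →
          HomLocOver 𝒜 S 𝔫 = HomLocR 𝒜 (𝔫.comap (algebraMap R S))) := by
  have := IsAddTorsionFree.of_not_isOfFinAddOrder hG
  let := hGr.gradedRing
  have flat_imp (_ : Module.Flat R S) (𝔭 : Ideal S) (_ : 𝔭.IsPrime) (_ : IsHomIdealOver 𝒜 S 𝔭) :
      HomLocOver 𝒜 S 𝔭 = HomLocR 𝒜 (𝔭.comap (algebraMap R S)) :=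
    homLocOver_eq_homLocR_of_flat hS 𝔭
  have prime_imp (h : ∀ 𝔭 : Ideal S, 𝔭.IsPrime → IsHomIdealOver 𝒜 S 𝔭 →
      HomLocOver 𝒜 S 𝔭 = HomLocR 𝒜 (𝔭.comap (algebraMap R S)))
      (𝔫 : Ideal S) (h𝔫 : IsGrMaxIdealOver 𝒜 S 𝔫) :
      HomLocOver 𝒜 S 𝔫 = HomLocR 𝒜 (𝔫.comap (algebraMap R S)) :=
    h 𝔫 (h𝔫.isPrime 𝒜 hS) h𝔫.1
  exact ⟨⟨flat_imp, fun h ↦ flat_of_homLocOver_eq_homLocR hS (prime_imp h)⟩,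
    ⟨prime_imp, fun h ↦ flat_imp (flat_of_homLocOver_eq_homLocR hS h)⟩⟩
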